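/- arXiv:2503.01331 — 2 statements merged into one kernel-verified Lean document; each statement's English description precedes it below -/
import Mathlib

section
/- Let 𝒜 be a unital C*-algebra and let σ : ℝ → ℝ → ℝ satisfy the betweenness property: for all reals 0 ≤ x ≤ y, x ≤ σ(x,y) ≤ y. If a ∈ 𝒜 is normal (a*a = aa*), then v(a) = ‖a‖_σ = ‖a*‖_σ = ‖a‖. -/
/-- A state on a unital C*-algebra `A`: a continuous linear functional `f : A → ℂ`
with `f 1 = 1` and `‖f‖ = 1`. -/
def IsState {A : Type*} [CStarAlgebra A] (f : A →L[ℂ] ℂ) : Prop :=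
  f 1 = 1 ∧ ‖f‖ = 1

/-- `‖a‖_σ := sup_{f ∈ S(A)} √(σ(|f(a)|², f(a*a)))`, where `f(a*a)` is the (nonnegative)
real number `(f (star a * a)).re`. -/
noncomputable def sigmaNorm {A : Type*} [CStarAlgebra A] (σ : ℝ → ℝ → ℝ) (a : A) : ℝ :=
  sSup {x : ℝ | ∃ f : A →L[ℂ] ℂ, IsState f ∧
    x = Real.sqrt (σ (‖f a‖ ^ 2) (f (star a * a)).re)}

/-- The algebraic numerical radius `v(a) := sup_{f ∈ S(A)} |f(a)|`. -/
noncomputable def numRadius {A : Type*} [CStarAlgebra A] (a : A) : ℝ :=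
  sSup {x : ℝ | ∃ f : A →L[ℂ] ℂ, IsState f ∧ x = ‖f a‖}

/-- The Crawford number `m(a) := inf_{f ∈ S(A)} |f(a)|`. -/
noncomputable def crawford {A : Type*} [CStarAlgebra A] (a : A) : ℝ :=
  sInf {x : ℝ | ∃ f : A →L[ℂ] ℂ, IsState f ∧ x = ‖f a‖}

/-- `‖a‖_∇ := sup_{f ∈ S(A)} √((|f(a)|² + f(a*a))/2)`. -/
noncomputable def nablaNorm {A : Type*} [CStarAlgebra A] (a : A) : ℝ :=
  sSup {x : ℝ | ∃ f : A →L[ℂ] ℂ, IsState f ∧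
    x = Real.sqrt ((‖f a‖ ^ 2 + (f (star a * a)).re) / 2)}

section States

variable {A : Type*} [CStarAlgebra A] {f : A →L[ℂ] ℂ}

lemma IsState.nontrivial (hf : IsState f) : Nontrivial A := by
  refine ⟨⟨1, 0, fun h => ?_⟩⟩
  have := hf.1
  simp [h] at this

lemma IsState.norm_apply_le (hf : IsState f) (x : A) : ‖f x‖ ≤ ‖x‖ := by
  simpa [hf.2] using f.le_opNorm x

lemma IsState.apply_smul_one (hf : IsState f) (z : ℂ) : f (z • 1) = z := by
  simp [hf.1]

lemma IsState.im_apply_eq_zero (hf : IsState f) {h : A} (hh : IsSelfAdjoint h) :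
    (f h).im = 0 := by
  have := hf.nontrivial
  have key (t : ℝ) : ((f h).im + t) ^ 2 ≤ ‖h‖ ^ 2 + t ^ 2 := by
    have h_norm : ‖h + ((t : ℂ) * Complex.I) • (1 : A)‖ ^ 2 ≤ ‖h‖ ^ 2 + t ^ 2 := by
      have h_eq : star (h + ((t : ℂ) * Complex.I) • (1 : A)) *
          (h + ((t : ℂ) * Complex.I) • (1 : A)) = h * h + ((t : ℂ) ^ 2) • (1 : A) := by
        simp only [star_add, hh.star_eq, star_smul, star_one, add_mul, mul_add, smul_mul_assoc,
          one_mul, mul_smul_comm, mul_one]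
        simp only [star_mul', RCLike.star_def, Complex.conj_ofReal, Complex.conj_I]
        match_scalars <;> ring_nf
        simp
      rw [sq, ← CStarRing.norm_star_mul_self, h_eq]
      refine (norm_add_le _ _).trans (add_le_add ?_ ?_)
      · rw [sq]; exact norm_mul_le _ _
      · simp [norm_smul]
    have h_im : (f (h + ((t : ℂ) * Complex.I) • (1 : A))).im = (f h).im + t := by
      rw [map_add, hf.apply_smul_one]; simp
    have h_abs := Complex.abs_im_le_norm (f (h + ((t : ℂ) * Complex.I) • (1 : A)))
    rw [h_im] at h_abs
    refine le_trans ?_ h_norm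
    rw [← sq_abs]
    exact pow_le_pow_left₀ (abs_nonneg _) (h_abs.trans (hf.norm_apply_le _)) 2
  by_contra hne
  have := key ((‖h‖ ^ 2 + 1) / (2 * (f h).im))
  have h_mul : 2 * (f h).im * ((‖h‖ ^ 2 + 1) / (2 * (f h).im)) = ‖h‖ ^ 2 + 1 := by
    field_simp
  nlinarith [sq_nonneg (f h).im]

lemma IsState.apply_star (hf : IsState f) (x : A) : f (star x) = star (f x) := by
  have h₁ := hf.im_apply_eq_zero (IsSelfAdjoint.add_star_self x)
  have h₂ := hf.im_apply_eq_zero (h := Complex.I • (x - star x)) (by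
    rw [IsSelfAdjoint, star_smul, star_sub, star_star]
    simp only [RCLike.star_def, Complex.conj_I]
    module)
  simp only [map_add, Complex.add_im] at h₁
  simp only [map_smul, map_sub, smul_eq_mul, Complex.mul_im, Complex.I_re, Complex.I_im,
    Complex.sub_re, zero_mul, one_mul, zero_add] at h₂
  apply Complex.ext
  · simp; linarith
  · simp; linarith

lemma IsState.re_apply_star_mul_self_nonneg (hf : IsState f) (x : A) :
    0 ≤ (f (star x * x)).re := by
  have h_le : ‖algebraMap ℝ A ‖star x * x‖ - star x * x‖ ≤ ‖star x * x‖ := by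
    have := (SpectrumRestricts.nnreal_iff_nnnorm (IsSelfAdjoint.star_mul_self x)
      (le_refl ‖star x * x‖₊)).1
      (SpectrumRestricts.nnreal_iff.2 spectrum_star_mul_self_nonneg)
    exact_mod_cast this
  have h_eq : algebraMap ℝ A ‖star x * x‖ = ((‖star x * x‖ : ℝ) : ℂ) • (1 : A) := by
    rw [Algebra.algebraMap_eq_smul_one, Complex.coe_smul]
  have h_re := (Complex.re_le_norm _).trans ((hf.norm_apply_le _).trans h_le)
  rw [h_eq, map_sub, hf.apply_smul_one, Complex.sub_re, Complex.ofReal_re] at h_re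
  linarith

lemma IsState.norm_apply_sq_le (hf : IsState f) (x : A) :
    ‖f x‖ ^ 2 ≤ (f (star x * x)).re := by
  have h := hf.re_apply_star_mul_self_nonneg (x - f x • 1)
  have h_eq : star (x - f x • (1 : A)) * (x - f x • 1) =
      star x * x - f x • star x - star (f x) • x + (star (f x) * f x) • (1 : A) := by
    simp only [star_sub, star_smul, star_one, sub_mul, mul_sub, smul_mul_assoc, one_mul,
      mul_smul_comm, mul_one]
    module
  rw [h_eq, map_add, map_sub, map_sub, map_smul, map_smul, hf.apply_star,
    hf.apply_smul_one] at h
  rw [← Complex.normSq_eq_norm_sq, Complex.normSq_apply]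
  simp at h
  linarith

lemma IsState.re_apply_star_mul_self_le (hf : IsState f) (x : A) :
    (f (star x * x)).re ≤ ‖x‖ ^ 2 := by
  rw [sq, ← CStarRing.norm_star_mul_self]
  exact (Complex.re_le_norm _).trans (hf.norm_apply_le _)

open WeakDual in
/-- The norm of a normal element is attained by the modulus of some state. -/
lemma exists_isState_norm_apply_eq [Nontrivial A] (a : A) [IsStarNormal a] :
    ∃ f : A →L[ℂ] ℂ, IsState f ∧ ‖f a‖ = ‖a‖ := by
  obtain ⟨z, hz, hz'⟩ := spectrum.exists_nnnorm_eq_spectralRadius a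
  rw [IsStarNormal.spectralRadius_eq_nnnorm] at hz'
  obtain ⟨φ, hφ⟩ := (StarAlgebra.elemental.bijective_characterSpaceToSpectrum a).2 ⟨z, hz⟩
  have hφa : φ ⟨a, StarAlgebra.elemental.self_mem ℂ a⟩ = z := congrArg Subtype.val hφ
  obtain ⟨g, hg, hg'⟩ := exists_extension_norm_eq
    (StarAlgebra.elemental ℂ a).toSubalgebra.toSubmodule (toStrongDual (φ : WeakDual ℂ _))
  have hg1 : g 1 = 1 := (hg (1 : StarAlgebra.elemental ℂ a)).trans (map_one φ)
  have hga : g a = z := (hg ⟨a, StarAlgebra.elemental.self_mem ℂ a⟩).trans hφa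
  refine ⟨g, ⟨hg1, le_antisymm ?_ ?_⟩, ?_⟩
  · rw [hg']
    refine (CharacterSpace.norm_le_norm_one φ).trans ?_
    exact (CStarRing.norm_one (E := A)).le
  · simpa [hg1] using g.le_opNorm 1
  · rw [hga]
    exact congrArg NNReal.toReal (ENNReal.coe_inj.1 hz')

lemma sSup_eq_norm_of_isState (a : A) [IsStarNormal a] (F : (A →L[ℂ] ℂ) → ℝ)
    (h_lower : ∀ f, IsState f → ‖f a‖ ≤ F f) (h_upper : ∀ f, IsState f → F f ≤ ‖a‖) :
    sSup {x : ℝ | ∃ f : A →L[ℂ] ℂ, IsState f ∧ x = F f} = ‖a‖ := by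
  rcases subsingleton_or_nontrivial A with hA | hA
  · have h_empty : {x : ℝ | ∃ f : A →L[ℂ] ℂ, IsState f ∧ x = F f} = ∅ := by
      refine Set.eq_empty_of_forall_notMem ?_
      rintro x ⟨f, hf, -⟩
      exact not_nontrivial_iff_subsingleton.2 hA hf.nontrivial
    rw [h_empty, Real.sSup_empty, Subsingleton.elim a 0, norm_zero]
  · obtain ⟨f, hf, hfa⟩ := exists_isState_norm_apply_eq a
    refine IsGreatest.csSup_eq ⟨⟨f, hf, ?_⟩, ?_⟩
    · exact le_antisymm (hfa ▸ h_lower f hf) (h_upper f hf)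
    · rintro x ⟨g, hg, rfl⟩
      exact h_upper g hg

lemma numRadius_eq_norm (a : A) [IsStarNormal a] : numRadius a = ‖a‖ :=
  sSup_eq_norm_of_isState a (fun f => ‖f a‖) (fun _ _ => le_rfl) fun _ hf => hf.norm_apply_le a

lemma sigmaNorm_eq_norm {σ : ℝ → ℝ → ℝ}
    (hσ : ∀ x y : ℝ, 0 ≤ x → x ≤ y → x ≤ σ x y ∧ σ x y ≤ y) (a : A) [IsStarNormal a] :
    sigmaNorm σ a = ‖a‖ := by
  refine sSup_eq_norm_of_isState a (fun f => √(σ (‖f a‖ ^ 2) (f (star a * a)).re))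
    (fun f hf => ?_) fun f hf => ?_
  · exact Real.le_sqrt_of_sq_le (hσ _ _ (sq_nonneg _) (hf.norm_apply_sq_le a)).1
  · exact Real.sqrt_le_iff.2 ⟨norm_nonneg a,
      (hσ _ _ (sq_nonneg _) (hf.norm_apply_sq_le a)).2.trans (hf.re_apply_star_mul_self_le a)⟩

end States

/-- If `σ` satisfies betweenness and `a` is normal, then `v(a) = ‖a‖_σ = ‖a*‖_σ = ‖a‖`. -/
theorem sigmaNorm_of_normal {A : Type*} [CStarAlgebra A] (σ : ℝ → ℝ → ℝ)
    (hσ : ∀ x y : ℝ, 0 ≤ x → x ≤ y → x ≤ σ x y ∧ σ x y ≤ y) (a : A)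
    (ha : star a * a = a * star a) :
    numRadius a = sigmaNorm σ a ∧ sigmaNorm σ a = sigmaNorm σ (star a) ∧
      sigmaNorm σ (star a) = ‖a‖ := by
  have : IsStarNormal a := ⟨ha⟩
  rw [numRadius_eq_norm, sigmaNorm_eq_norm hσ, sigmaNorm_eq_norm hσ, norm_star]
  exact ⟨rfl, rfl, rfl⟩
end

section
/- Let 𝒜 be a unital C*-algebra and let σ : ℝ → ℝ → ℝ be monotone in each argument on nonnegative reals and positively homogeneous (σ(αx, αy) = α·σ(x,y) for all α, x, y ≥ 0). Let 0 < α ≤ 1 ≤ β and let a ∈ 𝒜 be (α,β)-normal, i.e., α²·(a*a) ≤ aa* ≤ β²·(a*a) in the ordered C*-algebra 𝒜. Then α·‖a‖_σ ≤ ‖a*‖_σ ≤ β·‖a‖_σ. -/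
namespace IsState

variable {A : Type*} [CStarAlgebra A] {f : A →L[ℂ] ℂ}

lemma norm_apply_le_s7 (hf : IsState f) (a : A) : ‖f a‖ ≤ ‖a‖ := by
  simpa [hf.2] using f.le_opNorm a

lemma apply_algebraMap_real (hf : IsState f) (r : ℝ) : f (algebraMap ℝ A r) = r := by
  rw [Algebra.algebraMap_eq_smul_one, ← Complex.coe_smul, map_smul, hf.1]
  simp

lemma im_apply_eq_zero_s7 (hf : IsState f) {a : A} (ha : IsSelfAdjoint a) : (f a).im = 0 := by
  have hquad (t : ℝ) : ((f a).im + t) ^ 2 ≤ ‖a‖ ^ 2 + t ^ 2 := by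
    have hmap : f (a + (t * Complex.I) • (1 : A)) = f a + t * Complex.I := by
      simp [hf.1]
    have hstar : star (a + (t * Complex.I) • (1 : A)) * (a + (t * Complex.I) • (1 : A)) =
        a * a + ((t : ℂ) ^ 2) • (1 : A) := by
      have hsq : -((t : ℂ) * Complex.I * (t * Complex.I)) = (t : ℂ) ^ 2 := by
        linear_combination -(t : ℂ) ^ 2 * Complex.I_sq
      simp only [star_add, star_smul, star_one, ha.star_eq, star_mul', Complex.star_def,
        Complex.conj_I, Complex.conj_ofReal, add_mul, mul_add, smul_mul_assoc, mul_smul_comm,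
        one_mul, mul_one, mul_neg, neg_smul, neg_mul]
      rw [← hsq]
      module
    have hone : ‖(1 : A)‖ ≤ 1 := by
      nontriviality A
      simp
    have hnorm : ‖a + (t * Complex.I) • (1 : A)‖ ^ 2 ≤ ‖a‖ ^ 2 + t ^ 2 := by
      rw [sq, ← CStarRing.norm_star_mul_self, hstar]
      refine (norm_add_le _ _).trans (add_le_add ?_ ?_)
      · rw [sq]
        exact norm_mul_le a a
      · rw [norm_smul, norm_pow, Complex.norm_real, Real.norm_eq_abs, sq_abs]
        exact mul_le_of_le_one_right (sq_nonneg t) hone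
    have him : |(f a).im + t| ≤ ‖a + (t * Complex.I) • (1 : A)‖ := by
      have h := (Complex.abs_im_le_norm _).trans (hf.norm_apply_le_s7 (a + (t * Complex.I) • (1 : A)))
      rw [hmap] at h
      simpa using h
    calc ((f a).im + t) ^ 2 = |(f a).im + t| ^ 2 := (sq_abs _).symm
      _ ≤ ‖a + (t * Complex.I) • (1 : A)‖ ^ 2 := by gcongr
      _ ≤ _ := hnorm
  by_contra hne
  have h := hquad ((‖a‖ ^ 2 + 1) / (2 * (f a).im))
  have hcross : 2 * (f a).im * ((‖a‖ ^ 2 + 1) / (2 * (f a).im)) = ‖a‖ ^ 2 + 1 := by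
    field_simp
  nlinarith [sq_nonneg (f a).im]

lemma apply_star_s7 (hf : IsState f) (a : A) : f (star a) = star (f a) := by
  have hre := hf.im_apply_eq_zero_s7 (IsSelfAdjoint.add_star_self a)
  have hskew : IsSelfAdjoint (Complex.I • (a - star a)) := by
    simp [IsSelfAdjoint, star_smul, ← smul_neg]
  have him := hf.im_apply_eq_zero_s7 hskew
  simp only [map_add, map_smul, map_sub, smul_eq_mul, Complex.add_im, Complex.mul_im,
    Complex.I_re, Complex.I_im, Complex.sub_re, Complex.sub_im] at hre him
  apply Complex.ext <;> simp only [Complex.star_def, Complex.conj_re, Complex.conj_im] <;> linarith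

variable [PartialOrder A] [StarOrderedRing A]

lemma re_apply_nonneg (hf : IsState f) {b : A} (hb : 0 ≤ b) : 0 ≤ (f b).re := by
  have hle : b ≤ algebraMap ℝ A ‖b‖ := (IsSelfAdjoint.of_nonneg hb).le_algebraMap_norm_self
  have hnorm : ‖algebraMap ℝ A ‖b‖ - b‖ ≤ ‖b‖ :=
    (CStarAlgebra.norm_le_iff_le_algebraMap _ (norm_nonneg b) (sub_nonneg.2 hle)).2
      (sub_le_self _ hb)
  have h := (Complex.re_le_norm _).trans ((hf.norm_apply_le_s7 _).trans hnorm)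
  rw [map_sub, hf.apply_algebraMap_real, Complex.sub_re, Complex.ofReal_re] at h
  linarith

lemma re_apply_mono (hf : IsState f) {b c : A} (hbc : b ≤ c) : (f b).re ≤ (f c).re := by
  simpa using hf.re_apply_nonneg (sub_nonneg.2 hbc)

end IsState

section SigmaNorm

variable {A : Type*} [CStarAlgebra A] {σ : ℝ → ℝ → ℝ}

lemma bddAbove_sigmaNorm [PartialOrder A] [StarOrderedRing A]
    (hσ : ∀ x x' y y' : ℝ, 0 ≤ x → x ≤ x' → 0 ≤ y → y ≤ y' → σ x y ≤ σ x' y') (a : A) :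
    BddAbove {x : ℝ | ∃ f : A →L[ℂ] ℂ, IsState f ∧
      x = Real.sqrt (σ (‖f a‖ ^ 2) (f (star a * a)).re)} := by
  refine ⟨Real.sqrt (σ (‖a‖ ^ 2) ‖star a * a‖), ?_⟩
  rintro _ ⟨f, hf, rfl⟩
  exact Real.sqrt_le_sqrt (hσ _ _ _ _ (sq_nonneg _)
    (pow_le_pow_left₀ (norm_nonneg _) (hf.norm_apply_le_s7 a) 2)
    (hf.re_apply_nonneg (star_mul_self_nonneg a))
    ((Complex.re_le_norm _).trans (hf.norm_apply_le_s7 _)))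

lemma sigmaNorm_star_le [PartialOrder A] [StarOrderedRing A]
    (hσ : ∀ x x' y y' : ℝ, 0 ≤ x → x ≤ x' → 0 ≤ y → y ≤ y' → σ x y ≤ σ x' y')
    (hhom : ∀ c x y : ℝ, 0 ≤ c → 0 ≤ x → 0 ≤ y → σ (c * x) (c * y) = c * σ x y)
    {c : ℝ} (hc : 1 ≤ c) {a : A} (h : a * star a ≤ c ^ 2 • (star a * a)) :
    sigmaNorm σ (star a) ≤ c * sigmaNorm σ a := by
  have hc₀ : 0 ≤ c := zero_le_one.trans hc
  refine Real.sSup_le ?_ (mul_nonneg hc₀ (Real.sSup_nonneg ?_))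
  · rintro _ ⟨f, hf, rfl⟩
    have hpos := hf.re_apply_nonneg (star_mul_self_nonneg a)
    have hfh : (f (a * star a)).re ≤ c ^ 2 * (f (star a * a)).re := by
      have := hf.re_apply_mono h
      rwa [← Complex.coe_smul, map_smul, smul_eq_mul, Complex.re_ofReal_mul] at this
    calc Real.sqrt (σ (‖f (star a)‖ ^ 2) (f (star (star a) * star a)).re)
        ≤ Real.sqrt (σ (c ^ 2 * ‖f a‖ ^ 2) (c ^ 2 * (f (star a * a)).re)) := by
          rw [hf.apply_star_s7, norm_star, star_star]
          exact Real.sqrt_le_sqrt (hσ _ _ _ _ (sq_nonneg _)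
            (le_mul_of_one_le_left (sq_nonneg _) (one_le_pow₀ hc))
            (hf.re_apply_nonneg (mul_star_self_nonneg a)) hfh)
      _ = c * Real.sqrt (σ (‖f a‖ ^ 2) (f (star a * a)).re) := by
          rw [hhom _ _ _ (sq_nonneg c) (sq_nonneg _) hpos, Real.sqrt_mul (sq_nonneg c),
            Real.sqrt_sq hc₀]
      _ ≤ c * sigmaNorm σ a :=
          mul_le_mul_of_nonneg_left (le_csSup (bddAbove_sigmaNorm hσ a) ⟨f, hf, rfl⟩) hc₀
  · rintro _ ⟨f, -, rfl⟩
    exact Real.sqrt_nonneg _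

end SigmaNorm

/-- If `σ` is monotone and positively homogeneous on nonnegative reals, `0 < α ≤ 1 ≤ β`,
and `a` is `(α,β)`-normal (`α²(a*a) ≤ aa* ≤ β²(a*a)`), then `α‖a‖_σ ≤ ‖a*‖_σ ≤ β‖a‖_σ`. -/
theorem sigmaNorm_star_bounds_of_alpha_beta_normal {A : Type*} [CStarAlgebra A] [PartialOrder A]
    [StarOrderedRing A] (σ : ℝ → ℝ → ℝ)
    (hσ : ∀ x x' y y' : ℝ, 0 ≤ x → x ≤ x' → 0 ≤ y → y ≤ y' → σ x y ≤ σ x' y')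
    (hhom : ∀ c x y : ℝ, 0 ≤ c → 0 ≤ x → 0 ≤ y → σ (c * x) (c * y) = c * σ x y)
    (α β : ℝ) (hα : 0 < α) (hα1 : α ≤ 1) (hβ : 1 ≤ β) (a : A)
    (h₁ : α ^ 2 • (star a * a) ≤ a * star a) (h₂ : a * star a ≤ β ^ 2 • (star a * a)) :
    α * sigmaNorm σ a ≤ sigmaNorm σ (star a) ∧ sigmaNorm σ (star a) ≤ β * sigmaNorm σ a := by
  refine ⟨?_, sigmaNorm_star_le hσ hhom hβ h₂⟩
  have h : star a * star (star a) ≤ α⁻¹ ^ 2 • (star (star a) * star a) := by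
    have := smul_le_smul_of_nonneg_left h₁ (sq_nonneg α⁻¹)
    rwa [smul_smul, ← mul_pow, inv_mul_cancel₀ hα.ne', one_pow, one_smul, ← star_star a,
      star_star (star a)] at this
  have hle := sigmaNorm_star_le hσ hhom (one_le_inv_iff₀.2 ⟨hα, hα1⟩) h
  rw [star_star] at hle
  rwa [← le_inv_mul_iff₀ hα]
end
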